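/- arXiv:1908.11793 — 3 statements merged into one kernel-verified Lean document; each statement's English description precedes it below -/
import Mathlib

section
/- Let 𝔽_9 be a field with 9 elements containing 𝔽_3 and let α ∈ 𝔽_9 satisfy α² + 1 = 0. Define F : 𝔽_9³ → 𝔽_9 by F(x_1, x_2, x_3) = x_1x_2x_3 + x_1x_2 + x_3. Then as n → ∞, the real sequence (1/9^n) · #{x ∈ 𝔽_9^n : e_4(x) + F(x_1, x_2, x_3) = γ} (defined for n ≥ 3) converges to 2203/19683 for each γ in the prime subfield 𝔽_3 ⊆ 𝔽_9, and converges to 2179/19683 for each γ ∈ 𝔽_9 \ 𝔽_3. -/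
open Filter Topology

/-- The elementary symmetric polynomial of degree `k` evaluated at `x ∈ K^n`. -/
def evalE {K : Type*} [CommSemiring K] {n : ℕ} (k : ℕ) (x : Fin n → K) : K :=
  (Multiset.map x Finset.univ.val).esymm k

section walk
set_option linter.unusedSectionVars false
variable {K X : Type*} [Fintype K] [Fintype X]

/-- Averaging operator of the walk. -/
noncomputable def avgOp (T : K → X → X) (g : X → ℝ) : X → ℝ :=
  fun s => (∑ x, g (T x s)) / (Fintype.card K : ℝ)

lemma avgOp_le [Nonempty K] (T : K → X → X) (g : X → ℝ) (M : ℝ) (h : ∀ s, g s ≤ M) (s : X) :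
    avgOp T g s ≤ M := by
  unfold avgOp
  have hc : (0:ℝ) < Fintype.card K := by exact_mod_cast Fintype.card_pos
  rw [div_le_iff₀ hc]
  calc ∑ x, g (T x s) ≤ ∑ _x : K, M := Finset.sum_le_sum fun x _ => h _
    _ = M * Fintype.card K := by simp [mul_comm]

lemma le_avgOp [Nonempty K] (T : K → X → X) (g : X → ℝ) (M : ℝ) (h : ∀ s, M ≤ g s) (s : X) :
    M ≤ avgOp T g s := by
  unfold avgOp
  have hc : (0:ℝ) < Fintype.card K := by exact_mod_cast Fintype.card_pos
  rw [le_div_iff₀ hc]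
  calc M * Fintype.card K = ∑ _x : K, M := by simp [mul_comm]
    _ ≤ _ := Finset.sum_le_sum fun x _ => h _

lemma avgOp_iter_le [Nonempty K] (T : K → X → X) (g : X → ℝ) (M : ℝ) (h : ∀ s, g s ≤ M) (n : ℕ) :
    ∀ s, (avgOp T)^[n] g s ≤ M := by
  induction n with
  | zero => exact h
  | succ n ih =>
    intro s
    rw [Function.iterate_succ_apply']
    exact avgOp_le T _ M ih s

lemma le_avgOp_iter [Nonempty K] (T : K → X → X) (g : X → ℝ) (M : ℝ) (h : ∀ s, M ≤ g s) (n : ℕ) :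
    ∀ s, M ≤ (avgOp T)^[n] g s := by
  induction n with
  | zero => exact h
  | succ n ih =>
    intro s
    rw [Function.iterate_succ_apply']
    exact le_avgOp T _ M ih s

lemma avgOp_iter_word [Nonempty K] (T : K → X → X) (g : X → ℝ) (M : ℝ) (h : ∀ s, g s ≤ M)
    (l : List K) : ∀ s, (avgOp T)^[l.length] g s ≤
      M - (1 / (Fintype.card K : ℝ)) ^ l.length * (M - g (l.foldl (fun s x => T x s) s)) := by
  classical
  induction l with
  | nil => intro s; simp
  | cons a l ih =>
    intro s
    have hc : (0:ℝ) < Fintype.card K := by exact_mod_cast Fintype.card_pos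
    rw [List.length_cons, Function.iterate_succ_apply', List.foldl_cons]
    set D := (1 / (Fintype.card K : ℝ)) ^ l.length * (M - g (l.foldl (fun s x => T x s) (T a s)))
      with hD
    have h1 : ∑ x, (avgOp T)^[l.length] g (T x s) ≤ ∑ x : K, (M - if x = a then D else 0) := by
      apply Finset.sum_le_sum
      intro x _
      by_cases hx : x = a
      · subst hx; rw [if_pos rfl]; exact ih (T x s)
      · simpa [hx] using avgOp_iter_le T g M h l.length (T x s)
    rw [Finset.sum_sub_distrib] at h1
    simp only [Finset.sum_const, Finset.card_univ, nsmul_eq_mul, Finset.sum_ite_eq',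
      Finset.mem_univ, if_true] at h1
    unfold avgOp at h1 ⊢
    rw [div_le_iff₀ hc]
    refine h1.trans (le_of_eq ?_)
    rw [pow_succ]
    have : (1 / (Fintype.card K : ℝ)) ^ l.length * (1 / (Fintype.card K : ℝ)) *
      (M - g (l.foldl (fun s x => T x s) (T a s))) * Fintype.card K = D := by
      rw [hD]; field_simp
    linarith

lemma osc_contract [Nonempty K] [Nonempty X] (T : K → X → X) (k : ℕ)
    (hk : ∀ s s', ∃ l : List K, l.length = k ∧ l.foldl (fun s x => T x s) s = s')
    (g : X → ℝ) (c : ℝ) (h : ∀ s t, g s - g t ≤ c) (s t : X) :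
    (avgOp T)^[k] g s - (avgOp T)^[k] g t ≤ (1 - (1 / (Fintype.card K : ℝ)) ^ k) * c := by
  obtain ⟨s1, h1⟩ := Finite.exists_max g
  obtain ⟨s0, h0⟩ := Finite.exists_min g
  obtain ⟨l, rfl, hl⟩ := hk s s0
  have a1 := avgOp_iter_word T g (g s1) h1 l s
  rw [hl] at a1
  have a2 := le_avgOp_iter T g (g s0) h0 l.length t
  have hc : (1:ℝ) ≤ Fintype.card K := by exact_mod_cast Fintype.card_pos
  have hd : (1 / (Fintype.card K : ℝ)) ^ l.length ≤ 1 :=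
    pow_le_one₀ (by positivity) (by rw [div_le_one (by linarith)]; exact hc)
  have := mul_le_mul_of_nonneg_left (h s1 s0) (sub_nonneg.2 hd)
  nlinarith

lemma osc_iter [Nonempty K] [Nonempty X] (T : K → X → X) 
    (g : X → ℝ) (c : ℝ) (h : ∀ s t, g s - g t ≤ c) (n : ℕ) (s t : X) :
    (avgOp T)^[n] g s - (avgOp T)^[n] g t ≤ c := by
  obtain ⟨s1, h1⟩ := Finite.exists_max g
  obtain ⟨s0, h0⟩ := Finite.exists_min g
  have a1 := avgOp_iter_le T g (g s1) h1 n s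
  have a2 := le_avgOp_iter T g (g s0) h0 n t
  linarith [h s1 s0]

lemma osc_pow [Nonempty K] [Nonempty X] (T : K → X → X) (k : ℕ)
    (hk : ∀ s s', ∃ l : List K, l.length = k ∧ l.foldl (fun s x => T x s) s = s')
    (g : X → ℝ) (c : ℝ) (h : ∀ s t, g s - g t ≤ c) (j : ℕ) : ∀ (s t : X),
    (avgOp T)^[k * j] g s - (avgOp T)^[k * j] g t ≤
      (1 - (1 / (Fintype.card K : ℝ)) ^ k) ^ j * c := by
  induction j with
  | zero => simpa using h
  | succ j ih =>
    intro s t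
    have := osc_contract T k hk _ _ ih s t
    rw [← Function.iterate_add_apply] at this
    rw [show k * (j + 1) = k + k * j by ring]
    refine this.trans (le_of_eq (by ring))

lemma sum_avgOp_iter [Nonempty K] (T : K → X → X) (hT : ∀ x, Function.Bijective (T x))
    (g : X → ℝ) (n : ℕ) : ∑ s, (avgOp T)^[n] g s = ∑ s, g s := by
  induction n with
  | zero => rfl
  | succ n ih =>
    rw [Function.iterate_succ_apply']
    have hc : (Fintype.card K : ℝ) ≠ 0 := by exact_mod_cast Fintype.card_ne_zero
    unfold avgOp at ih ⊢
    rw [← Finset.sum_div, Finset.sum_comm, div_eq_iff hc, ← ih]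
    rw [Finset.sum_congr rfl fun x _ => (hT x).sum_comp _]
    simp [mul_comm]

theorem walk_tendsto [Nonempty K] [Nonempty X] (T : K → X → X)
    (hT : ∀ x, Function.Bijective (T x)) (k : ℕ)
    (hk : ∀ s s', ∃ l : List K, l.length = k ∧ l.foldl (fun s x => T x s) s = s')
    (g : X → ℝ) (s : X) :
    Tendsto (fun n : ℕ => (avgOp T)^[n] g s) atTop (𝓝 ((∑ s, g s) / Fintype.card X)) := by
  obtain ⟨s1, h1⟩ := Finite.exists_max g
  obtain ⟨s0, h0⟩ := Finite.exists_min g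
  set c := g s1 - g s0
  have h : ∀ s t, g s - g t ≤ c := fun s t => by linarith [h1 s, h0 t]
  have hc : (1:ℝ) ≤ Fintype.card K := by exact_mod_cast Fintype.card_pos
  have hd : (1 / (Fintype.card K : ℝ)) ^ k ≤ 1 :=
    pow_le_one₀ (by positivity) (by rw [div_le_one (by linarith)]; exact hc)
  have hd' : 0 < (1 / (Fintype.card K : ℝ)) ^ k := by positivity
  have ht : Tendsto (fun j : ℕ => (1 - (1 / (Fintype.card K : ℝ)) ^ k) ^ j * c) atTop
      (𝓝 (0 * c)) :=
    (tendsto_pow_atTop_nhds_zero_of_lt_one (by linarith) (by linarith)).mul_const c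
  rw [zero_mul] at ht
  rw [Metric.tendsto_atTop]
  intro ε hε
  obtain ⟨j, hj⟩ := (ht.eventually (gt_mem_nhds hε)).exists
  refine ⟨k * j, fun n hn => ?_⟩
  obtain ⟨m, rfl⟩ := Nat.exists_eq_add_of_le hn
  have hX : (0:ℝ) < Fintype.card X := by exact_mod_cast Fintype.card_pos
  have key : ∀ s t, (avgOp T)^[k * j + m] g s - (avgOp T)^[k * j + m] g t ≤
      (1 - (1 / (Fintype.card K : ℝ)) ^ k) ^ j * c := by
    rw [add_comm, Function.iterate_add_apply]
    exact osc_iter T _ _ (osc_pow T k hk g c h j) m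
  rw [← sum_avgOp_iter T hT g (k * j + m)]
  set G := (avgOp T)^[k * j + m] g
  set d := (1 - (1 / (Fintype.card K : ℝ)) ^ k) ^ j * c
  refine lt_of_le_of_lt ?_ hj
  rw [Real.dist_eq, abs_le]
  constructor
  · have : (∑ t, G t) / Fintype.card X ≤ G s + d := by
      rw [div_le_iff₀ hX]
      calc ∑ t, G t ≤ ∑ _t : X, (G s + d) :=
            Finset.sum_le_sum fun t _ => by linarith [key t s]
        _ = _ := by rw [Finset.sum_const, Finset.card_univ, nsmul_eq_mul, mul_comm]
    linarith
  · have : G s - d ≤ (∑ t, G t) / Fintype.card X := by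
      rw [le_div_iff₀ hX]
      calc (G s - d) * Fintype.card X = ∑ _t : X, (G s - d) := by
            rw [Finset.sum_const, Finset.card_univ, nsmul_eq_mul, mul_comm]
        _ ≤ _ := Finset.sum_le_sum fun t _ => by linarith [key s t]
    linarith

end walk

section state
set_option linter.unusedSectionVars false
variable {K : Type*} [Field K]

lemma esymm_cons' (a : K) (m : Multiset K) (k : ℕ) :
    (a ::ₘ m).esymm (k + 1) = m.esymm (k + 1) + a * m.esymm k := by
  simp only [Multiset.esymm, Multiset.powersetCard_cons, Multiset.map_add, Multiset.sum_add,
    Multiset.map_map, Function.comp_def, Multiset.prod_cons, Multiset.sum_map_mul_left]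

/-- Step of the walk on `(e₁, e₂, e₃, p₄)`. -/
def stepT (χ : K → ZMod 3) (x : K) (s : K × K × K × ZMod 3) : K × K × K × ZMod 3 :=
  (s.1 + x, s.2.1 + x * s.1, s.2.2.1 + x * s.2.1, s.2.2.2 + χ x)

/-- The state `(e₁, e₂, e₃, p₄)` of a multiset. -/
def mstate (χ : K → ZMod 3) (m : Multiset K) : K × K × K × ZMod 3 :=
  (m.esymm 1, m.esymm 2, m.esymm 3, (m.map χ).sum)

lemma esymm_zero' (m : Multiset K) : m.esymm 0 = 1 := by
  simp [Multiset.esymm]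

lemma mstate_cons (χ : K → ZMod 3) (a : K) (m : Multiset K) :
    mstate χ (a ::ₘ m) = stepT χ a (mstate χ m) := by
  simp only [mstate, stepT, esymm_cons' a m 0, esymm_cons' a m 1, esymm_cons' a m 2,
    esymm_zero', Multiset.map_cons, Multiset.sum_cons, zero_add, mul_one, Nat.reduceAdd]
  rw [add_comm (χ a)]

lemma stepT_bij (χ : K → ZMod 3) (x : K) : Function.Bijective (stepT χ x) := by
  rw [Function.bijective_iff_has_inverse]
  refine ⟨fun s => (s.1 - x, s.2.1 - x * (s.1 - x), s.2.2.1 - x * (s.2.1 - x * (s.1 - x)),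
    s.2.2.2 - χ x), ?_, ?_⟩
  · rintro ⟨a, b, c, d⟩; simp [stepT]
  · rintro ⟨a, b, c, d⟩; simp [stepT]

variable [CharP K 3]

/-- The embedding of the prime field. -/
noncomputable def emb (K : Type*) [Field K] [CharP K 3] : ZMod 3 →+* K := ZMod.castHom dvd_rfl K

lemma three0 : (3 : K) = 0 := by exact_mod_cast CharP.cast_eq_zero K 3

/-- `e₄` as a function of the state. -/
noncomputable def e4of (s : K × K × K × ZMod 3) : K :=
  s.1 ^ 4 - s.1 ^ 2 * s.2.1 - s.2.1 ^ 2 + s.1 * s.2.2.1 - emb K s.2.2.2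

lemma newton4 (χ : K → ZMod 3) (hχ : ∀ x, emb K (χ x) = x ^ 4) (m : Multiset K) :
    emb K (m.map χ).sum = m.esymm 1 ^ 4 - 4 * m.esymm 1 ^ 2 * m.esymm 2 + 2 * m.esymm 2 ^ 2
      + 4 * m.esymm 1 * m.esymm 3 - 4 * m.esymm 4 := by
  induction m using Multiset.induction with
  | empty =>
    have h0 : ∀ k, (0 : Multiset K).esymm (k + 1) = 0 := fun k => by
      simp [Multiset.esymm, Multiset.powersetCard_zero_right]
    simp [h0 0, h0 1, h0 2, h0 3]
  | cons a m ih =>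
    simp only [esymm_cons' a m 0, esymm_cons' a m 1, esymm_cons' a m 2, esymm_cons' a m 3,
    esymm_zero', Multiset.map_cons, Multiset.sum_cons, zero_add, mul_one, Nat.reduceAdd, map_add,
    hχ, ih]
    ring

lemma e4_mstate (χ : K → ZMod 3) (hχ : ∀ x, emb K (χ x) = x ^ 4) (m : Multiset K) :
    m.esymm 4 = e4of (mstate χ m) := by
  simp only [e4of, mstate, newton4 χ hχ m]
  linear_combination (- m.esymm 1 ^ 2 * m.esymm 2 + m.esymm 2 ^ 2 + m.esymm 1 * m.esymm 3
    - m.esymm 4) * three0 (K := K)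

lemma reach (χ : K → ZMod 3) (hχ : ∀ x, emb K (χ x) = x ^ 4) (hF : ∀ x : K, x ^ 9 = x)
    (α : K) (hα : α ^ 2 + 1 = 0) (s s' : K × K × K × ZMod 3) :
    ∃ l : List K, l.length = 12 ∧ l.foldl (fun s x => stepT χ x s) s = s' := by
  have h3 := three0 (K := K)
  have hinj : Function.Injective (emb K) := (emb K).injective
  have hneg : ∀ x, χ (-x) = χ x := fun x => hinj (by rw [hχ, hχ]; ring)
  have hmul : ∀ x, χ (α * x) = χ x := fun x => hinj (by
    rw [hχ, hχ]; linear_combination (α ^ 2 - 1) * x ^ 4 * hα)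
  have t3 : (3 : ZMod 3) = 0 := rfl
  have r2 : ∀ (s : K × K × K × ZMod 3) (t : K), ∃ (l : List K) (c : K) (q : ZMod 3),
      l.length = 4 ∧ l.foldl (fun s x => stepT χ x s) s = (s.1, t, c, q) := by
    rintro ⟨a, b, c, d⟩ t
    refine ⟨[α * (t - b + 1), -(α * (t - b + 1)), (t - b - 1), -(t - b - 1)],
      (List.foldl (fun s x => stepT χ x s) (a, b, c, d)
        [α * (t - b + 1), -(α * (t - b + 1)), (t - b - 1), -(t - b - 1)]).2.2.1,
      (List.foldl (fun s x => stepT χ x s) (a, b, c, d)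
        [α * (t - b + 1), -(α * (t - b + 1)), (t - b - 1), -(t - b - 1)]).2.2.2, rfl, ?_⟩
    simp only [List.foldl_cons, List.foldl_nil, stepT, Prod.mk.injEq]
    refine ⟨by ring, ?_, trivial⟩
    linear_combination (-(t - b + 1) ^ 2) * hα + (t - b) * h3
  have r4 : ∀ (s : K × K × K × ZMod 3) (t : ZMod 3), ∃ (l : List K),
      l.length = 4 ∧ l.foldl (fun s x => stepT χ x s) s = (s.1, s.2.1, s.2.2.1, t) := by
    rintro ⟨a, b, c, d⟩ t
    have hz : ∀ u : ZMod 3, ∃ z : K, χ z = u := by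
      intro u
      have : u = 0 ∨ u = 1 ∨ u = -1 := by revert u; decide
      rcases this with rfl | rfl | rfl
      · exact ⟨0, hinj (by rw [hχ]; simp)⟩
      · exact ⟨1, hinj (by rw [hχ]; simp)⟩
      · refine ⟨1 + α, hinj ?_⟩
        rw [hχ, map_neg, map_one]
        linear_combination (α ^ 2 + 4 * α + 5) * hα - h3
    obtain ⟨z, hz⟩ := hz (t - d)
    refine ⟨[z, -z, α * z, -(α * z)], rfl, ?_⟩
    simp only [List.foldl_cons, List.foldl_nil, stepT, Prod.mk.injEq, hneg, hmul, hz]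
    refine ⟨by ring, ?_, ?_, ?_⟩
    · linear_combination (-z ^ 2) * hα
    · linear_combination (-a * z ^ 2) * hα
    · linear_combination (t - d) * t3
  have r3 : ∀ (s : K × K × K × ZMod 3) (t : K), ∃ (l : List K),
      l.length = 3 ∧ l.foldl (fun s x => stepT χ x s) s = (s.1, s.2.1, t, s.2.2.2) := by
    rintro ⟨a, b, c, d⟩ t
    refine ⟨[(t - c) ^ 3, (t - c) ^ 3, (t - c) ^ 3], rfl, ?_⟩
    simp only [List.foldl_cons, List.foldl_nil, stepT, Prod.mk.injEq]
    refine ⟨?_, ?_, ?_, ?_⟩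
    · linear_combination (t - c) ^ 3 * h3
    · linear_combination ((t - c) ^ 3 * a + (t - c) ^ 6) * h3
    · linear_combination ((t - c) ^ 3 * b + (t - c) ^ 6 * a) * h3 + hF (t - c)
    · linear_combination χ ((t - c) ^ 3) * t3
  obtain ⟨ta, tb, tc, td⟩ := s'
  obtain ⟨l2, c2, q2, hl2, h2⟩ := r2 (stepT χ (ta - s.1) s) tb
  obtain ⟨l4, hl4, h4⟩ := r4 ((stepT χ (ta - s.1) s).1, tb, c2, q2) td
  obtain ⟨l3, hl3, h3'⟩ := r3 ((stepT χ (ta - s.1) s).1, tb, c2, td) tc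
  refine ⟨(ta - s.1) :: (l2 ++ l4 ++ l3), by simp [hl2, hl3, hl4], ?_⟩
  rw [List.foldl_cons, List.foldl_append, List.foldl_append, h2, h4, h3']
  simp [stepT]

end state

section counting
set_option linter.unusedSectionVars false
variable {K : Type*} [Field K] [Fintype K]

lemma sum_cons_fin {M : Type*} [AddCommMonoid M] {n : ℕ} (g : (Fin (n + 1) → K) → M) :
    ∑ v, g v = ∑ a, ∑ v : Fin n → K, g (Fin.cons a v) := by
  rw [← Fintype.sum_prod_type' (f := fun a v => g (Fin.cons a v))]
  exact (Fintype.sum_equiv (Fin.consEquiv fun _ : Fin (n + 1) => K) _ _ fun _ => rfl).symm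

lemma map_cons_fin {n : ℕ} (a : K) (v : Fin n → K) :
    Multiset.map (Fin.cons a v : Fin (n + 1) → K) Finset.univ.val
      = a ::ₘ Multiset.map v Finset.univ.val := by
  rw [Fin.univ_succ]
  simp [Function.comp_def]

lemma map_append_fin {k n : ℕ} (u : Fin k → K) (v : Fin n → K) :
    Multiset.map (Fin.append u v) Finset.univ.val
      = Multiset.map u Finset.univ.val + Multiset.map v Finset.univ.val := by
  rw [Fin.univ_val_map, Fin.univ_val_map, Fin.univ_val_map, List.ofFn_fin_append]
  rfl

lemma sum_walk (χ : K → ZMod 3) (g : K × K × K × ZMod 3 → ℝ) (n : ℕ) : ∀ m : Multiset K,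
    ∑ v : Fin n → K, g (mstate χ (m + Multiset.map v Finset.univ.val)) =
      (Fintype.card K : ℝ) ^ n * (avgOp (stepT χ))^[n] g (mstate χ m) := by
  induction n with
  | zero => intro m; simp
  | succ n ih =>
    intro m
    have hc : (Fintype.card K : ℝ) ≠ 0 := by exact_mod_cast Fintype.card_ne_zero
    rw [sum_cons_fin, Function.iterate_succ_apply', avgOp]
    simp only [map_cons_fin, Multiset.add_cons]
    simp only [← Multiset.cons_add, ih, mstate_cons]
    rw [← Finset.mul_sum]
    field_simp
    ring

variable [CharP K 3] [DecidableEq K]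

/-- Membership in the prime field. -/
def inP (δ : K) : Prop := ∃ m : ℤ, (m : K) = δ

lemma inP_iff (δ : K) : inP δ ↔ ∃ c : ZMod 3, emb K c = δ := by
  constructor
  · rintro ⟨m, rfl⟩; exact ⟨m, by simp⟩
  · rintro ⟨c, rfl⟩
    obtain ⟨m, rfl⟩ := ZMod.intCast_surjective c
    exact ⟨m, by simp⟩

/-- Coordinates with respect to `1, α`. -/
noncomputable def coords (α : K) (p : ZMod 3 × ZMod 3) : K := emb K p.1 + emb K p.2 * α

lemma alpha_notin (α : K) (hα : α ^ 2 + 1 = 0) (c : ZMod 3) : emb K c ≠ α := by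
  rintro rfl
  have h0 : emb K (c ^ 2 + 1) = emb K 0 := by simpa using hα
  have this := (emb K).injective h0
  clear hα
  have key : ∀ c : ZMod 3, c ^ 2 + 1 ≠ 0 := by decide
  exact key c this

lemma coords_inj (α : K) (hα : α ^ 2 + 1 = 0) : Function.Injective (coords α) := by
  rintro ⟨a, b⟩ ⟨c, d⟩ h
  simp only [coords] at h
  have hbd : b = d := by
    by_contra hne
    have h1 : emb K d - emb K b ≠ 0 := by
      rw [← map_sub]; intro h0
      exact hne (sub_eq_zero.1 ((map_eq_zero_iff _ (emb K).injective).1 h0)).symm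
    apply alpha_notin α hα ((a - c) / (d - b))
    rw [map_div₀, map_sub, map_sub, div_eq_iff h1]
    linear_combination h
  subst hbd
  have : emb K a = emb K c := by linear_combination h
  rw [(emb K).injective this]

lemma coords_bij (hK : Fintype.card K = 9) (α : K) (hα : α ^ 2 + 1 = 0) :
    Function.Bijective (coords α) := by
  rw [Fintype.bijective_iff_injective_and_card]
  refine ⟨coords_inj α hα, ?_⟩
  rw [hK]; simp [ZMod.card]

lemma inP_coords (α : K) (hα : α ^ 2 + 1 = 0) (c d : ZMod 3) : inP (coords α (c, d)) ↔ d = 0 := by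
  rw [inP_iff]
  constructor
  · rintro ⟨e, he⟩
    have : coords α (e, 0) = coords α (c, d) := by rw [← he]; simp [coords]
    simpa using (congrArg Prod.snd (coords_inj α hα this)).symm
  · rintro rfl; exact ⟨c, by simp [coords]⟩

open Classical in
lemma sum_inP (hK : Fintype.card K = 9) (α : K) (hα : α ^ 2 + 1 = 0) :
    ∑ δ : K, (if inP δ then 1 else 0 : ℕ) = 3 := by
  rw [← (coords_bij hK α hα).sum_comp, Fintype.sum_prod_type]
  simp only [inP_coords α hα]
  simp

open Classical in
lemma count_M (hK : Fintype.card K = 9) (α : K) (hα : α ^ 2 + 1 = 0) (δ : K) :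
    ∑ e : K, ∑ q : ZMod 3, (if -e ^ 2 - emb K q = δ then 1 else 0 : ℕ)
      = if inP δ then 5 else 2 := by
  obtain ⟨⟨c, d⟩, rfl⟩ := (coords_bij hK α hα).2 δ
  rw [← (coords_bij hK α hα).sum_comp, Fintype.sum_prod_type]
  simp only [inP_coords α hα]
  have : ∀ a b q : ZMod 3, (-(coords α (a, b)) ^ 2 - emb K q = coords α (c, d)) ↔
      (b ^ 2 - a ^ 2 - q = c ∧ a * b = d) := by
    intro a b q
    have : -(coords α (a, b)) ^ 2 - emb K q = coords α (b ^ 2 - a ^ 2 - q, a * b) := by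
      simp only [coords, map_sub, map_pow, map_mul]
      linear_combination (-(emb K b) ^ 2) * hα - emb K a * emb K b * α * three0 (K := K)
    rw [this, (coords_inj α hα).eq_iff, Prod.mk.injEq]
  simp only [this]
  clear this
  have key : ∀ c d : ZMod 3, ∑ a : ZMod 3, ∑ b : ZMod 3, ∑ q : ZMod 3,
    (if b ^ 2 - a ^ 2 - q = c ∧ a * b = d then 1 else 0 : ℕ) = if d = 0 then 5 else 2 := by
    decide
  convert key c d

open Classical in
lemma count_N (hK : Fintype.card K = 9) (α : K) (hα : α ^ 2 + 1 = 0) (δ : K) :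
    ∑ s : K × K × K × ZMod 3, (if e4of s = δ then 1 else 0 : ℕ)
      = if inP δ then 261 else 234 := by
  have h1 : ∀ e1 : K, ∑ r : K × K × ZMod 3, (if e4of (e1, r) = δ then 1 else 0 : ℕ)
      = if e1 = 0 then 9 * (if inP δ then 5 else 2) else 27 := by
    intro e1
    rw [Fintype.sum_prod_type]
    simp only [Fintype.sum_prod_type]
    split_ifs with h0 hp
    · subst h0
      have := count_M hK α hα δ
      rw [if_pos hp] at this
      have h5 : ∀ (a b : K) (q : ZMod 3), e4of (0, a, b, q) = -a ^ 2 - emb K q := by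
        intro a b q; simp [e4of]
      simp only [h5, Finset.sum_const, Finset.card_univ, hK, smul_eq_mul, ← Finset.mul_sum, this]
    · subst h0
      have := count_M hK α hα δ
      rw [if_neg hp] at this
      have h5 : ∀ (a b : K) (q : ZMod 3), e4of (0, a, b, q) = -a ^ 2 - emb K q := by
        intro a b q; simp [e4of]
      simp only [h5, Finset.sum_const, Finset.card_univ, hK, smul_eq_mul, ← Finset.mul_sum, this]
    · have : ∀ e2 : K, ∑ e3 : K, ∑ q : ZMod 3,
          (if e4of (e1, e2, e3, q) = δ then 1 else 0 : ℕ) = 3 := by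
        intro e2
        rw [Finset.sum_comm]
        have : ∀ q e3, e4of (e1, e2, e3, q) = δ ↔
            e3 = (δ - (e1 ^ 4 - e1 ^ 2 * e2 - e2 ^ 2 - emb K q)) / e1 := by
          intro q e3
          rw [eq_div_iff h0]
          simp only [e4of]
          constructor <;> intro h <;> linear_combination h
        simp [this]
      simp only [this, Finset.sum_const, Finset.card_univ, hK, smul_eq_mul]
  rw [Fintype.sum_prod_type]
  simp only [h1]
  rw [Finset.sum_ite]
  have : (Finset.univ.filter fun x : K => ¬ x = 0).card = 8 := by
    rw [Finset.filter_not, Finset.card_sdiff]; simp [hK, Finset.filter_eq']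
  rw [Finset.sum_const, Finset.sum_const, this]
  simp only [Finset.filter_eq', Finset.mem_univ, if_true, Finset.card_singleton]
  split_ifs <;> rfl

open Classical in
lemma count_A (hK : Fintype.card K = 9) (α : K) (hα : α ^ 2 + 1 = 0) (γ : K) :
    ∑ u : Fin 3 → K, (if inP (γ - (u 0 * u 1 * u 2 + u 0 * u 1 + u 2)) then 1 else 0 : ℕ)
      = if inP γ then 291 else 219 := by
  have hsub : inP (γ + 1) ↔ inP γ := by
    constructor
    · rintro ⟨m, hm⟩; exact ⟨m - 1, by push_cast; linear_combination hm⟩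
    · rintro ⟨m, hm⟩; exact ⟨m + 1, by push_cast; linear_combination hm⟩
  have h1 : ∀ a b : K, ∑ x : K, (if inP (γ - (a * b * x + a * b + x)) then 1 else 0 : ℕ)
      = if a * b + 1 = 0 then (if inP γ then 9 else 0) else 3 := by
    intro a b
    by_cases h : a * b + 1 = 0
    · have : ∀ x, γ - (a * b * x + a * b + x) = γ + 1 := by
        intro x; linear_combination (-x - 1) * h
      simp only [this, hsub, h, if_true]
      split_ifs <;> simp [hK]
    · rw [if_neg h, ← sum_inP hK α hα]
      refine Function.Bijective.sum_comp (e := fun x => γ - (a * b * x + a * b + x)) ?_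
        (fun δ => (if inP δ then 1 else 0 : ℕ))
      apply Function.Injective.bijective_of_finite
      intro x y hxy
      have : (a * b + 1) * (x - y) = 0 := by simp only at hxy; linear_combination -hxy
      rcases mul_eq_zero.1 this with h' | h'
      · exact absurd h' h
      · exact sub_eq_zero.1 h'
  have h2 : ∀ a : K, ∑ b : K, (if a * b + 1 = 0 then (if inP γ then 9 else 0) else 3 : ℕ)
      = if a = 0 then 27 else 24 + (if inP γ then 9 else 0) := by
    intro a
    by_cases ha : a = 0
    · subst ha; simp [hK]
    · have : ∀ b, a * b + 1 = 0 ↔ b = -1 / a := by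
        intro b; rw [eq_div_iff ha]
        constructor <;> intro h <;> linear_combination h
      simp only [this, if_neg ha]
      rw [Finset.sum_ite, Finset.sum_const, Finset.sum_const, Finset.filter_not,
        Finset.card_sdiff]
      simp [hK, Finset.filter_eq']
      omega
  rw [sum_cons_fin]
  simp only [sum_cons_fin (n := 1), sum_cons_fin (n := 0)]
  have h3 : ∀ a b c : K, ∀ v : Fin 0 → K,
      (Fin.cons a (Fin.cons b (Fin.cons c v : Fin 1 → K) : Fin 2 → K) : Fin 3 → K) 2 = c :=
    fun _ _ _ _ => rfl
  have h4 : ∀ a b c : K, ∀ v : Fin 0 → K,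
      (Fin.cons a (Fin.cons b (Fin.cons c v : Fin 1 → K) : Fin 2 → K) : Fin 3 → K) 1 = b :=
    fun _ _ _ _ => rfl
  simp only [h3, h4, Fin.cons_zero, Finset.univ_unique, Finset.sum_singleton, h1, h2]
  rw [Finset.sum_ite]
  have : (Finset.univ.filter fun x : K => ¬ x = 0).card = 8 := by
    rw [Finset.filter_not, Finset.card_sdiff]; simp [hK, Finset.filter_eq']
  rw [Finset.sum_const, Finset.sum_const, this]
  simp only [Finset.filter_eq', Finset.mem_univ, if_true, Finset.card_singleton]
  split_ifs <;> rfl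

open Classical in
lemma count_total (hK : Fintype.card K = 9) (α : K) (hα : α ^ 2 + 1 = 0) (γ : K) :
    ∑ u : Fin 3 → K, ∑ s : K × K × K × ZMod 3,
      (if e4of s + (u 0 * u 1 * u 2 + u 0 * u 1 + u 2) = γ then 1 else 0 : ℕ)
      = if inP γ then 178443 else 176499 := by
  simp only [← eq_sub_iff_add_eq, count_N hK α hα]
  have h := count_A hK α hα γ
  have : ∀ u : Fin 3 → K, (if inP (γ - (u 0 * u 1 * u 2 + u 0 * u 1 + u 2)) then 261 else 234 : ℕ)
     = 27 * (if inP (γ - (u 0 * u 1 * u 2 + u 0 * u 1 + u 2)) then 1 else 0) + 234 := by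
    intro u; split_ifs <;> rfl
  simp only [this, Finset.sum_add_distrib, ← Finset.mul_sum, h]
  simp [hK]
  split_ifs <;> rfl

open Classical in
lemma main_aux (hK : Fintype.card K = 9) (α : K) (hα : α ^ 2 + 1 = 0) (γ : K) :
    Tendsto (fun n : ℕ =>
          ((Finset.univ.filter (fun x : Fin (3 + n) → K =>
              evalE 4 x +
                (x (Fin.castAdd n 0) * x (Fin.castAdd n 1) * x (Fin.castAdd n 2) +
                  x (Fin.castAdd n 0) * x (Fin.castAdd n 1) + x (Fin.castAdd n 2)) =
                γ)).card : ℝ) / (9 : ℝ) ^ (3 + n))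
        atTop (𝓝 ((if inP γ then 178443 else 176499 : ℕ) / 1594323)) := by
  have hF : ∀ x : K, x ^ 9 = x := fun x => by rw [← hK]; exact FiniteField.pow_card x
  have hχ : ∀ x : K, ∃ c : ZMod 3, emb K c = x ^ 4 := by
    intro x
    by_cases hx : x = 0
    · exact ⟨0, by simp [hx]⟩
    · have h8 : x * ((x ^ 4 - 1) * (x ^ 4 + 1)) = 0 := by linear_combination hF x
      rcases mul_eq_zero.1 h8 with h | h
      · exact absurd h hx
      · rcases mul_eq_zero.1 h with h | h
        · exact ⟨1, by rw [map_one]; linear_combination -h⟩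
        · exact ⟨-1, by rw [map_neg, map_one]; linear_combination -h⟩
  choose χ hχ using hχ
  let F : (Fin 3 → K) → K := fun u => u 0 * u 1 * u 2 + u 0 * u 1 + u 2
  let g : (Fin 3 → K) → (K × K × K × ZMod 3) → ℝ := fun u s => if e4of s + F u = γ then 1 else 0
  have hlim : Tendsto (fun n : ℕ => (∑ u : Fin 3 → K, (avgOp (stepT χ))^[n] (g u)
      (mstate χ (Multiset.map u Finset.univ.val))) / 729) atTop
      (𝓝 ((∑ u : Fin 3 → K, ((∑ s, g u s) / Fintype.card (K × K × K × ZMod 3))) / 729)) := by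
    apply Tendsto.div_const
    apply tendsto_finsetSum
    intro u _
    exact walk_tendsto (stepT χ) (stepT_bij χ) 12 (reach χ hχ hF α hα) (g u) _
  have hval : (∑ u : Fin 3 → K, ((∑ s, g u s) / Fintype.card (K × K × K × ZMod 3) : ℝ)) / 729
      = ((if inP γ then 178443 else 176499 : ℕ) / 1594323 : ℝ) := by
    rw [← count_total hK α hα γ, ← Finset.sum_div]
    simp only [Fintype.card_prod, hK, ZMod.card, g, F]
    push_cast
    rw [div_div]
    norm_num
  rw [← hval]
  refine hlim.congr fun n => ?_
  have hcard : ((Finset.univ.filter (fun x : Fin (3 + n) → K =>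
              evalE 4 x +
                (x (Fin.castAdd n 0) * x (Fin.castAdd n 1) * x (Fin.castAdd n 2) +
                  x (Fin.castAdd n 0) * x (Fin.castAdd n 1) + x (Fin.castAdd n 2)) =
                γ)).card : ℝ) = 9 ^ n * ∑ u : Fin 3 → K, (avgOp (stepT χ))^[n] (g u)
      (mstate χ (Multiset.map u Finset.univ.val)) := by
    rw [Finset.card_filter, Nat.cast_sum, ← (Fin.appendEquiv 3 n).sum_comp,
      Fintype.sum_prod_type, Finset.mul_sum]
    refine Finset.sum_congr rfl fun u _ => ?_
    have := sum_walk χ (g u) n (Multiset.map u Finset.univ.val)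
    rw [hK] at this
    push_cast at this
    rw [← this]
    refine Finset.sum_congr rfl fun v _ => ?_
    simp only [Fin.appendEquiv, Equiv.coe_fn_mk, evalE, map_append_fin, Fin.append_left,
      e4_mstate χ hχ, g, F]
    split_ifs <;> simp
  rw [hcard, pow_add]
  field_simp
  norm_num

end counting

/-- **Example 3.4.** Over `𝔽_9 = 𝔽_3(α)` with `α² + 1 = 0`, for the
perturbation `e_{n,4} + F` with `F(x₁,x₂,x₃) = x₁x₂x₃ + x₁x₂ + x₃`, the limiting value
distribution is `2203/19683` at each element of the prime subfield `𝔽_3` and `2179/19683`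
at each element of `𝔽_9 \ 𝔽_3`. -/
theorem limit_distribution_F9_e4_perturbed (K : Type*) [Field K] [Fintype K] [DecidableEq K]
    (hK : Fintype.card K = 9) (α : K) (hα : α ^ 2 + 1 = 0) :
    (∀ γ : K, (∃ m : ℤ, (m : K) = γ) →
      Tendsto (fun n : ℕ =>
          ((Finset.univ.filter (fun x : Fin (3 + n) → K =>
              evalE 4 x +
                (x (Fin.castAdd n 0) * x (Fin.castAdd n 1) * x (Fin.castAdd n 2) +
                  x (Fin.castAdd n 0) * x (Fin.castAdd n 1) + x (Fin.castAdd n 2)) =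
                γ)).card : ℝ) / (9 : ℝ) ^ (3 + n))
        atTop (𝓝 (2203 / 19683))) ∧
    (∀ γ : K, (¬ ∃ m : ℤ, (m : K) = γ) →
      Tendsto (fun n : ℕ =>
          ((Finset.univ.filter (fun x : Fin (3 + n) → K =>
              evalE 4 x +
                (x (Fin.castAdd n 0) * x (Fin.castAdd n 1) * x (Fin.castAdd n 2) +
                  x (Fin.castAdd n 0) * x (Fin.castAdd n 1) + x (Fin.castAdd n 2)) =
                γ)).card : ℝ) / (9 : ℝ) ^ (3 + n))
        atTop (𝓝 (2179 / 19683))) := by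
  have h9 : (9 : K) = 0 := by
    have := FiniteField.cast_card_eq_zero K
    rw [hK] at this; exact_mod_cast this
  have h3 : (3 : K) = 0 := by
    have : (3 : K) * 3 = 0 := by linear_combination h9
    simpa using this
  have : CharP K 3 := (CharP.charP_iff_prime_eq_zero Nat.prime_three).2 (by exact_mod_cast h3)
  constructor
  · intro γ hγ
    have := main_aux hK α hα γ
    rw [if_pos (show inP γ from hγ)] at this
    convert this using 2
    norm_num
  · intro γ hγ
    have := main_aux hK α hα γ
    rw [if_neg (show ¬ inP γ from hγ)] at this
    convert this using 2
    norm_num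
end

section
/- Let 𝔽_4 be a field with 4 elements. For every integer j ≥ 1 and every function F : 𝔽_4^j → 𝔽_4, the following are equivalent: (i) for every γ ∈ 𝔽_4, the real sequence (1/4^n) · #{x ∈ 𝔽_4^n : e_9(x) + F(x_1,…,x_j) = γ} (defined for n ≥ j) converges to 1/4 as n → ∞; (ii) F is balanced, i.e. #{β ∈ 𝔽_4^j : F(β) = t} = 4^{j−1} for every t ∈ 𝔽_4. -/
open Filter Topology

theorem walk_equidist {K G : Type*} [Fintype K] [DecidableEq K] [AddCommGroup G] [Fintype G]
    [DecidableEq G] (s : K → G) (k0 : K) (h0 : s k0 = 0)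
    (hs : ∀ ψ : AddChar G ℂ, (∀ a, ψ (s a) = 1) → ψ = 0) (v : G) :
    Tendsto (fun n : ℕ =>
      ((Finset.univ.filter (fun y : Fin n → K => ∑ i, s (y i) = v)).card : ℝ) /
        (Fintype.card K : ℝ) ^ n) atTop (𝓝 (1 / Fintype.card G)) := by
  have hGpos : (Fintype.card G : ℂ) ≠ 0 := by
    have : Nonempty G := ⟨0⟩
    exact_mod_cast Fintype.card_ne_zero
  have hKpos : (Fintype.card K : ℂ) ≠ 0 := by
    have : Nonempty K := ⟨k0⟩
    exact_mod_cast Fintype.card_ne_zero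
  have key : ∀ n : ℕ, (((Finset.univ.filter (fun y : Fin n → K => ∑ i, s (y i) = v)).card : ℂ)) /
        (Fintype.card K : ℂ) ^ n = (1 / (Fintype.card G : ℂ)) * ∑ ψ : AddChar G ℂ,
          ψ (-v) * ((∑ a, ψ (s a)) / Fintype.card K) ^ n := by
    intro n
    have h1 : ∀ ψ : AddChar G ℂ, (∑ a, ψ (s a)) ^ n = ∑ y : Fin n → K, ψ (∑ i, s (y i)) := by
      intro ψ
      rw [Fintype.sum_pow]
      refine Finset.sum_congr rfl fun y _ => ?_
      exact (map_prod ψ.toMonoidHom (fun i => Multiplicative.ofAdd (s (y i))) Finset.univ).symm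
    have h2 : (((Finset.univ.filter (fun y : Fin n → K => ∑ i, s (y i) = v)).card : ℂ))
        = (1 / (Fintype.card G : ℂ)) * ∑ y : Fin n → K, ∑ ψ : AddChar G ℂ,
          ψ (∑ i, s (y i) - v) := by
      simp_rw [AddChar.sum_apply_eq_ite, sub_eq_zero]
      rw [← Finset.sum_filter, Finset.sum_const, nsmul_eq_mul]
      field_simp
    rw [h2, Finset.sum_comm, mul_div_assoc, Finset.sum_div]
    congr 1
    refine Finset.sum_congr rfl fun ψ _ => ?_
    rw [div_pow, h1, mul_div_assoc', Finset.mul_sum]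
    congr 1
    refine Finset.sum_congr rfl fun y _ => ?_
    rw [sub_eq_neg_add, AddChar.map_add_eq_mul]
  have hlim : Tendsto (fun n : ℕ => (1 / (Fintype.card G : ℂ)) * ∑ ψ : AddChar G ℂ,
          ψ (-v) * ((∑ a, ψ (s a)) / Fintype.card K) ^ n) atTop
          (𝓝 ((1 / (Fintype.card G : ℂ)) * ∑ ψ : AddChar G ℂ, if ψ = 0 then 1 else 0)) := by
    refine Tendsto.const_mul _ (tendsto_finsetSum _ fun ψ _ => ?_)
    split_ifs with hψ
    · subst hψ
      simp [div_self hKpos]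
    · have hex : ∃ a, ψ (s a) ≠ 1 := by
        by_contra hcon
        push Not at hcon
        exact hψ (hs ψ hcon)
      obtain ⟨a, ha⟩ := hex
      have hne : k0 ≠ a := by
        rintro rfl
        simp [h0] at ha
      have hlt2 : ‖ψ (s k0) + ψ (s a)‖ < 2 := by
        refine lt_of_le_of_ne ?_ ?_
        · refine (norm_add_le _ _).trans ?_
          rw [AddChar.norm_apply, AddChar.norm_apply]; norm_num
        · intro h
          apply ha
          have := eq_of_norm_eq_of_norm_add_eq (x := ψ (s k0)) (y := ψ (s a)) (by
            rw [AddChar.norm_apply, AddChar.norm_apply]) (by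
            rw [AddChar.norm_apply, AddChar.norm_apply, h]; norm_num)
          rw [← this, h0, AddChar.map_zero_eq_one]
      have hlt : ‖(∑ a, ψ (s a)) / (Fintype.card K : ℂ)‖ < 1 := by
        rw [norm_div, Complex.norm_natCast, div_lt_one (by
          have : Nonempty K := ⟨k0⟩
          exact_mod_cast Fintype.card_pos)]
        have hsub : ({k0, a} : Finset K) ⊆ Finset.univ := Finset.subset_univ _
        rw [← Finset.sum_sdiff hsub, Finset.sum_pair hne]
        have hc : ‖∑ x ∈ Finset.univ \ {k0, a}, ψ (s x)‖ ≤ ((Finset.univ \ {k0, a} : Finset K).card : ℝ) := by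
          refine (norm_sum_le _ _).trans ?_
          simp [AddChar.norm_apply]
        have hcard : (Finset.univ \ {k0, a} : Finset K).card + 2 = Fintype.card K := by
          rw [← Finset.card_pair hne, Finset.card_sdiff_add_card_eq_card hsub, Finset.card_univ]
        have hcard' : ((Finset.univ \ {k0, a} : Finset K).card : ℝ) + 2 = Fintype.card K := by
          exact_mod_cast hcard
        refine (norm_add_le _ _).trans_lt ?_
        linarith
      simpa using (tendsto_pow_atTop_nhds_zero_of_norm_lt_one hlt).const_mul (ψ (-v))
  simp only [Finset.sum_ite_eq', Finset.mem_univ, if_true, mul_one] at hlim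
  rw [← Filter.tendsto_ofReal_iff ]
  refine Tendsto.congr (fun n => (key n).symm.trans ?_) (by simpa using hlim)
  push_cast
  rfl

/-- Multiply by `1 + T`. -/
def stepA (p : ℕ × ℕ) : ℕ × ℕ := (p.1 ^^^ (p.1 <<< 1), p.2 ^^^ (p.2 <<< 1))
/-- Multiply by `1 + ω T`. -/
def stepB (p : ℕ × ℕ) : ℕ × ℕ := (p.1 ^^^ (p.2 <<< 1), p.2 ^^^ ((p.1 ^^^ p.2) <<< 1))
/-- Multiply by `1 + ω² T`. -/
def stepC (p : ℕ × ℕ) : ℕ × ℕ := (p.1 ^^^ ((p.1 ^^^ p.2) <<< 1), p.2 ^^^ (p.1 <<< 1))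

abbrev G16 := ZMod 16 × ZMod 16 × ZMod 16

def code (v : G16) : ℕ × ℕ := stepA^[v.1.val] (stepB^[v.2.1.val] (stepC^[v.2.2.val] (1, 0)))

def bits (v : G16) : Bool × Bool := ((code v).1.testBit 9, (code v).2.testBit 9)

set_option maxRecDepth 100000 in
theorem bits_count (b : Bool × Bool) : (Finset.univ.filter (fun v : G16 => bits v = b)).card =
    if b = (false, false) then 1440 else if b = (true, false) then 928 else 864 := by
  revert b
  decide +kernel

section
open Polynomial
theorem coeff_prod_eq_esymm {K : Type*} [CommRing K] (s : Multiset K) (k : ℕ) :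
    ((s.map (fun a => (1 + C a * X : K[X]))).prod).coeff k = s.esymm k := by
  induction s using Multiset.induction_on generalizing k with
  | empty =>
    cases k with
    | zero => simp [Multiset.esymm]
    | succ k => simp [Multiset.esymm, coeff_one, Multiset.powersetCard_zero_right]
  | cons a s ih =>
    rw [Multiset.map_cons, Multiset.prod_cons, add_mul, one_mul, coeff_add, mul_assoc, coeff_C_mul]
    cases k with
    | zero =>
      rw [ih]
      simp [Multiset.esymm]
    | succ k =>
      rw [coeff_X_mul, ih, ih]
      simp only [Multiset.esymm, Multiset.powersetCard_cons, Multiset.map_add, Multiset.sum_add,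
        Multiset.map_map, Function.comp_def, Multiset.prod_cons, Multiset.sum_map_mul_left]

theorem evalE_eq_coeff {K : Type*} [CommRing K] {n : ℕ} (k : ℕ) (x : Fin n → K) :
    evalE k x = (∏ i, (1 + C (x i) * X : K[X])).coeff k := by
  rw [evalE, ← coeff_prod_eq_esymm, Multiset.map_map]
  rfl

/-- The explicit polynomial attached to a triple of multiplicities modulo 16. -/
noncomputable def polyQ {K : Type*} [CommRing K] (w : K) (v : G16) : K[X] :=
  (1 + C 1 * X) ^ v.1.val * ((1 + C w * X) ^ v.2.1.val * (1 + C (w + 1) * X) ^ v.2.2.val)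

/-- The step attached to a field element. -/
def stepS {K : Type*} [CommRing K] [DecidableEq K] (w a : K) : G16 :=
  if a = 0 then 0 else if a = 1 then (1, 0, 0) else if a = w then (0, 1, 0) else (0, 0, 1)

/-- The embedding of bit pairs. -/
def bitK {K : Type*} [CommRing K] (w : K) (b : Bool × Bool) : K :=
  (if b.1 then 1 else 0) + (if b.2 then w else 0)

section
set_option linter.unusedSectionVars false
variable {K : Type*} [Field K] [CharP K 2] (w : K)

theorem bitsum (b c : Bool) : (if (b ^^ c) then (1 : K) else 0) = (if b then 1 else 0) + (if c then 1 else 0) := by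
  have h2 : (1 : K) + 1 = 0 := CharTwo.add_self_eq_zero 1
  cases b <;> cases c <;> simp [h2]

theorem bitsumw (b c : Bool) : (if (b ^^ c) then w else 0) = (if b then w else 0) + (if c then w else 0) := by
  have h2 : w + w = 0 := CharTwo.add_self_eq_zero w
  cases b <;> cases c <;> simp [h2]

/-- The code represents the polynomial. -/
def CodeRep (p : ℕ × ℕ) (P : K[X]) : Prop := ∀ k, P.coeff k = bitK w (p.1.testBit k, p.2.testBit k)

theorem rep_one : CodeRep w (1, 0) 1 := by
  intro k
  cases k with
  | zero => simp [bitK]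
  | succ k => simp [bitK, coeff_one, Nat.testBit_succ]

theorem rep_stepA (p : ℕ × ℕ) (P : K[X]) (h : CodeRep w p P) : CodeRep w (stepA p) ((1 + C 1 * X) * P) := by
  intro k
  rw [add_mul, one_mul, coeff_add, mul_assoc, coeff_C_mul, h k]
  cases k with
  | zero =>
    simp only [bitK, stepA, Nat.testBit_xor, Nat.testBit_shiftLeft]
    simp
  | succ k =>
    rw [coeff_X_mul, h k]
    simp only [bitK, stepA, Nat.testBit_xor, Nat.testBit_shiftLeft, ge_iff_le, Nat.le_add_left,
      decide_true, Bool.true_and, Nat.add_sub_cancel, bitsumw]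
    generalize p.1.testBit k = c
    generalize p.2.testBit k = d
    rw [one_mul]
    ring

theorem rep_stepB (hw : w ^ 2 = w + 1) (p : ℕ × ℕ) (P : K[X]) (h : CodeRep w p P) :
    CodeRep w (stepB p) ((1 + C w * X) * P) := by
  intro k
  rw [add_mul, one_mul, coeff_add, mul_assoc, coeff_C_mul, h k]
  cases k with
  | zero =>
    simp only [bitK, stepB, Nat.testBit_xor, Nat.testBit_shiftLeft]
    simp
  | succ k =>
    rw [coeff_X_mul, h k]
    simp only [bitK, stepB, Nat.testBit_xor, Nat.testBit_shiftLeft, ge_iff_le, Nat.le_add_left,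
      decide_true, Bool.true_and, Nat.add_sub_cancel, bitsumw]
    generalize p.1.testBit k = c
    generalize p.2.testBit k = d
    cases c <;> cases d <;> simp <;> first | ring1 | linear_combination hw

theorem rep_stepC (hw : w ^ 2 = w + 1) (p : ℕ × ℕ) (P : K[X]) (h : CodeRep w p P) :
    CodeRep w (stepC p) ((1 + C (w + 1) * X) * P) := by
  intro k
  have h2 : (2 : K) = 0 := CharTwo.two_eq_zero
  rw [add_mul, one_mul, coeff_add, mul_assoc, coeff_C_mul, h k]
  cases k with
  | zero =>
    simp only [bitK, stepC, Nat.testBit_xor, Nat.testBit_shiftLeft]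
    simp
  | succ k =>
    rw [coeff_X_mul, h k]
    simp only [bitK, stepC, Nat.testBit_xor, Nat.testBit_shiftLeft, ge_iff_le, Nat.le_add_left,
      decide_true, Bool.true_and, Nat.add_sub_cancel, bitsumw]
    generalize p.1.testBit k = c
    generalize p.2.testBit k = d
    cases c <;> cases d <;> simp <;>
      first | ring1 | linear_combination hw + w * h2 | linear_combination hw

theorem rep_iter (f : ℕ × ℕ → ℕ × ℕ) (A : K[X]) (hf : ∀ p P, CodeRep w p P → CodeRep w (f p) (A * P))
    (m : ℕ) (p : ℕ × ℕ) (P : K[X]) (h : CodeRep w p P) : CodeRep w (f^[m] p) (A ^ m * P) := by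
  induction m with
  | zero => simpa using h
  | succ m ih =>
    rw [Function.iterate_succ_apply', pow_succ', mul_assoc]
    exact hf _ _ ih

theorem coeff_polyQ (hw : w ^ 2 = w + 1) (v : G16) : (polyQ w v).coeff 9 = bitK w (bits v) := by
  have h3 := rep_iter w stepC _ (rep_stepC w hw) v.2.2.val _ _ (rep_one w)
  have h2 := rep_iter w stepB _ (rep_stepB w hw) v.2.1.val _ _ h3
  have h1 := rep_iter w stepA _ (rep_stepA w) v.1.val _ _ h2
  rw [mul_one] at h1
  exact h1 9

theorem mk_pow16 (a : K) :
    (Ideal.Quotient.mk (Ideal.span {(X : K[X]) ^ 10}) (1 + C a * X)) ^ 16 = 1 := by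
  rw [← map_pow, ← map_one (Ideal.Quotient.mk _), Ideal.Quotient.eq, Ideal.mem_span_singleton]
  have : (1 + C a * X : K[X]) ^ 16 = 1 + (C a * X) ^ 16 := by
    have := add_pow_char_pow (R := K[X]) (p := 2) (n := 4) (x := 1) (y := C a * X)
    simpa using this
  rw [this, mul_pow]
  exact ⟨C a ^ 16 * X ^ 6, by ring⟩

theorem mk_pow_add (a : K) (m n : ZMod 16) :
    (Ideal.Quotient.mk (Ideal.span {(X : K[X]) ^ 10}) (1 + C a * X)) ^ (m + n).val =
    (Ideal.Quotient.mk (Ideal.span {(X : K[X]) ^ 10}) (1 + C a * X)) ^ m.val *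
    (Ideal.Quotient.mk (Ideal.span {(X : K[X]) ^ 10}) (1 + C a * X)) ^ n.val := by
  rw [ZMod.val_add, ← pow_eq_pow_mod _ (mk_pow16 a), pow_add]

theorem mk_polyQ_add (v u : G16) :
    (Ideal.Quotient.mk (Ideal.span {(X : K[X]) ^ 10}) (polyQ w (v + u))) =
    (Ideal.Quotient.mk (Ideal.span {(X : K[X]) ^ 10}) (polyQ w v)) *
    (Ideal.Quotient.mk (Ideal.span {(X : K[X]) ^ 10}) (polyQ w u)) := by
  simp only [polyQ, map_mul, map_pow, Prod.fst_add, Prod.snd_add, mk_pow_add]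
  ring

theorem val16_one : (1 : ZMod 16).val = 1 := rfl

theorem polyQ_stepS [DecidableEq K] (hall : ∀ a : K, a = 0 ∨ a = 1 ∨ a = w ∨ a = w + 1)
    (a : K) : polyQ w (stepS w a) = 1 + C a * X := by
  unfold stepS
  split_ifs with h0 h1 hw
  · subst h0; simp [polyQ]
  · subst h1; simp [polyQ, val16_one]
  · subst hw; simp [polyQ, val16_one]
  · have : a = w + 1 := by
      rcases hall a with h | h | h | h <;> first | exact h | contradiction
    subst this; simp [polyQ, val16_one]

theorem evalE_nine [DecidableEq K] (hw : w ^ 2 = w + 1)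
    (hall : ∀ a : K, a = 0 ∨ a = 1 ∨ a = w ∨ a = w + 1) {n : ℕ} (x : Fin n → K) :
    evalE 9 x = bitK w (bits (∑ i, stepS w (x i))) := by
  rw [evalE_eq_coeff, ← coeff_polyQ w hw]
  have key : ∀ s : Finset (Fin n),
      (Ideal.Quotient.mk (Ideal.span {(X : K[X]) ^ 10}) (∏ i ∈ s, (1 + C (x i) * X))) =
      (Ideal.Quotient.mk (Ideal.span {(X : K[X]) ^ 10}) (polyQ w (∑ i ∈ s, stepS w (x i)))) := by
    intro s
    induction s using Finset.induction_on with
    | empty => simp [polyQ]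
    | insert i s hi ih =>
      rw [Finset.prod_insert hi, Finset.sum_insert hi, mk_polyQ_add, map_mul, ih, polyQ_stepS w hall]
  have := key Finset.univ
  rw [Ideal.Quotient.eq, Ideal.mem_span_singleton, X_pow_dvd_iff] at this
  have h9 := this 9 (by norm_num)
  rwa [coeff_sub, sub_eq_zero] at h9
end

theorem stepS_chars {K : Type*} [Field K] [DecidableEq K] (w : K) (hw0 : w ≠ 0) (hw1 : w ≠ 1)
    (hw2 : w + 1 ≠ 0)     (ψ : AddChar G16 ℂ) (h : ∀ a : K, ψ (stepS w a) = 1) : ψ = 0 := by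
  have e1 : ψ (1, 0, 0) = 1 := by simpa [stepS] using h 1
  have e2 : ψ (0, 1, 0) = 1 := by simpa [stepS, hw0, hw1] using h w
  have e3 : ψ (0, 0, 1) = 1 := by
    simpa [stepS, hw0, hw1, hw2] using h (w + 1)
  ext v
  have hv : v = v.1.val • ((1, 0, 0) : G16) + (v.2.1.val • ((0, 1, 0) : G16)
      + v.2.2.val • ((0, 0, 1) : G16)) := by
    obtain ⟨a, b, c⟩ := v
    simp
  rw [hv, AddChar.map_add_eq_mul, AddChar.map_add_eq_mul, AddChar.map_nsmul_eq_pow,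
    AddChar.map_nsmul_eq_pow, AddChar.map_nsmul_eq_pow, e1, e2, e3]
  simp

end

theorem exists_omega (K : Type*) [Field K] [Fintype K] [DecidableEq K]
    (hK : Fintype.card K = 4) : CharP K 2 ∧ ∃ w : K, w ≠ 0 ∧ w ≠ 1 ∧ w + 1 ≠ 0 ∧ w ^ 2 = w + 1 ∧
      (Finset.univ : Finset K) = {0, 1, w, w + 1} := by
  have h4 : (4 : K) = 0 := by
    have := Nat.cast_card_eq_zero K
    rw [hK] at this
    exact_mod_cast this
  have h2 : (2 : K) = 0 := by
    have : (2 : K) * 2 = 0 := by rw [← h4]; norm_num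
    simpa using this
  have hchar : CharP K 2 := CharTwo.of_one_ne_zero_of_two_eq_zero one_ne_zero h2
  refine ⟨hchar, ?_⟩
  have hex : ∃ w : K, w ∉ ({0, 1} : Finset K) := by
    by_contra hcon
    push Not at hcon
    have : (Finset.univ : Finset K) ⊆ {0, 1} := fun a _ => hcon a
    have := Finset.card_le_card this
    rw [Finset.card_univ, hK] at this
    have h' : ({0, 1} : Finset K).card ≤ 2 := Finset.card_le_two
    omega
  obtain ⟨w, hw⟩ := hex
  have hw0 : w ≠ 0 := fun h => hw (by simp [h])
  have hw1 : w ≠ 1 := fun h => hw (by simp [h])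
  have hw2 : w + 1 ≠ 0 := fun h => hw1 (by linear_combination h - h2)
  have huniv : (Finset.univ : Finset K) = {0, 1, w, w + 1} := by
    symm
    apply Finset.eq_univ_of_card
    rw [hK, Finset.card_insert_of_notMem, Finset.card_insert_of_notMem, Finset.card_pair]
    · simp
    · simp [hw1.symm, hw0]
    · simp [hw0.symm, hw2.symm]
  refine ⟨w, hw0, hw1, hw2, ?_, huniv⟩
  have hm : w ^ 2 ∈ (Finset.univ : Finset K) := Finset.mem_univ _
  rw [huniv] at hm
  simp only [Finset.mem_insert, Finset.mem_singleton] at hm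
  rcases hm with h | h | h | h
  · exact absurd (pow_eq_zero_iff (by norm_num) |>.1 h) hw0
  · have : (w + 1) ^ 2 = 0 := by linear_combination h + (w + 1) * h2
    exact absurd (pow_eq_zero_iff (by norm_num) |>.1 this) hw2
  · have : w * (w - 1) = 0 := by linear_combination h
    rcases mul_eq_zero.1 this with h | h
    · exact absurd h hw0
    · exact absurd (sub_eq_zero.1 h) hw1
  · exact h

/-- Generic limit of the perturbed count. -/
theorem perturbed_limit {K G : Type*} [Fintype K] [DecidableEq K] [AddCommGroup G] [Fintype G]
    [DecidableEq G] (s : K → G) (k0 : K) (h0 : s k0 = 0)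
    (hs : ∀ ψ : AddChar G ℂ, (∀ a, ψ (s a) = 1) → ψ = 0) (j : ℕ)
    (p : (Fin j → K) → G → Prop) [∀ β, DecidablePred (p β)] :
    Tendsto (fun n : ℕ =>
      ((Finset.univ.filter (fun x : Fin (j + n) → K =>
        p (fun i => x (Fin.castAdd n i)) (∑ i, s (x i)))).card : ℝ) /
        (Fintype.card K : ℝ) ^ (j + n)) atTop
      (𝓝 ((∑ β : Fin j → K, ((Finset.univ.filter (fun v : G => p β v)).card : ℝ)) /
        ((Fintype.card G : ℝ) * (Fintype.card K : ℝ) ^ j))) := by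
  have hcount : ∀ n : ℕ, ((Finset.univ.filter (fun x : Fin (j + n) → K =>
        p (fun i => x (Fin.castAdd n i)) (∑ i, s (x i)))).card : ℝ) =
      ∑ β : Fin j → K, ∑ v ∈ Finset.univ.filter (fun v : G => p β v),
        ((Finset.univ.filter (fun y : Fin n → K => ∑ i, s (y i) = v - ∑ i, s (β i))).card : ℝ) := by
    intro n
    simp only [Finset.card_filter, Nat.cast_sum]
    rw [← (Fin.appendEquiv j n).sum_comp, Fintype.sum_prod_type]
    refine Finset.sum_congr rfl fun β _ => ?_
    rw [Finset.sum_comm]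
    refine Finset.sum_congr rfl fun y _ => ?_
    simp only [Fin.appendEquiv, Equiv.coe_fn_mk, Fin.append_left, Fin.append_right, Fin.sum_univ_add, eq_sub_iff_add_eq', Nat.cast_ite, Nat.cast_one, Nat.cast_zero]
    rw [Finset.sum_ite_eq]
    simp
  have hlim := tendsto_finsetSum (Finset.univ : Finset (Fin j → K)) fun β _ =>
    tendsto_finsetSum (Finset.univ.filter (fun v : G => p β v)) fun v _ =>
      (walk_equidist s k0 h0 hs (v - ∑ i, s (β i))).div_const ((Fintype.card K : ℝ) ^ j)
  convert hlim using 2 with n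
  · rw [hcount, Finset.sum_div]
    refine Finset.sum_congr rfl fun β _ => ?_
    rw [Finset.sum_div]
    refine Finset.sum_congr rfl fun v _ => ?_
    rw [div_div, pow_add, mul_comm]
  · rw [Finset.sum_div]
    refine Finset.sum_congr rfl fun β _ => ?_
    rw [Finset.sum_const, nsmul_eq_mul, div_div, mul_one_div]

theorem bitK_count {K : Type*} [Field K] [DecidableEq K] [CharP K 2] (w : K) (hw0 : w ≠ 0)
    (hw1 : w ≠ 1) (hw2 : w + 1 ≠ 0) (b : Bool × Bool) :
    (Finset.univ.filter (fun v : G16 => bitK w (bits v) = bitK w b)).card =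
    if b = (false, false) then 1440 else if b = (true, false) then 928 else 864 := by
  rw [← bits_count]
  congr 1
  ext v
  simp only [Finset.mem_filter, Finset.mem_univ, true_and]
  generalize bits v = d
  have hw3 : 1 + w ≠ 0 := by rwa [add_comm]
  constructor
  · obtain ⟨b1, b2⟩ := b
    obtain ⟨d1, d2⟩ := d
    cases b1 <;> cases b2 <;> cases d1 <;> cases d2 <;>
      simp [bitK, hw0, hw1, hw0.symm, hw1.symm, hw3, hw3.symm]
  · rintro rfl; rfl

/-- **Example 3.7.** Over `𝔽_4`, a perturbation `e_{n,9} + F` is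
asymptotically balanced if and only if `F` is balanced. -/
theorem asympBalanced_perturbation_F4_e9_iff (K : Type*) [Field K] [Fintype K] [DecidableEq K]
    (hK : Fintype.card K = 4) (j : ℕ) (hj : 1 ≤ j) (F : (Fin j → K) → K) :
    (∀ γ : K,
      Tendsto
        (fun n : ℕ =>
          ((Finset.univ.filter (fun x : Fin (j + n) → K =>
              evalE 9 x + F (fun i => x (Fin.castAdd n i)) = γ)).card : ℝ) /
            (4 : ℝ) ^ (j + n))
        atTop (𝓝 (1 / 4))) ↔
    (∀ t : K,
      (Finset.univ.filter (fun β : Fin j → K => F β = t)).card = 4 ^ (j - 1)) := by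
  obtain ⟨hchar, w, hw0, hw1, hw2, hw, huniv⟩ := exists_omega K hK
  have hall : ∀ a : K, a = 0 ∨ a = 1 ∨ a = w ∨ a = w + 1 := by
    intro a
    have := Finset.mem_univ a
    rw [huniv] at this
    simpa using this
  have h2 : (2 : K) = 0 := CharTwo.two_eq_zero
  -- the weights
  set c : K → ℝ := fun t => ((Finset.univ.filter (fun v : G16 => bitK w (bits v) = t)).card : ℝ) with hc
  have c0 : c 0 = 1440 := by
    have := bitK_count w hw0 hw1 hw2 (false, false)
    simp [bitK] at this
    simp only [hc, bitK]
    exact_mod_cast this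
  have c1 : c 1 = 928 := by
    have := bitK_count w hw0 hw1 hw2 (true, false)
    simp [bitK] at this
    simp only [hc, bitK]
    exact_mod_cast this
  have c2 : c w = 864 := by
    have := bitK_count w hw0 hw1 hw2 (false, true)
    simp [bitK] at this
    simp only [hc, bitK]
    exact_mod_cast this
  have c3 : c (w + 1) = 864 := by
    have := bitK_count w hw0 hw1 hw2 (true, true)
    simp [bitK] at this
    simp only [hc, bitK, add_comm w 1]
    exact_mod_cast this
  set f : K → ℝ := fun t => ((Finset.univ.filter (fun β : Fin j → K => F β = t)).card : ℝ) with hf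
  have hsumK : ∀ g : K → ℝ, ∑ t, g t = g 0 + g 1 + g w + g (w + 1) := by
    intro g
    rw [huniv, Finset.sum_insert, Finset.sum_insert, Finset.sum_pair]
    · ring
    · simp
    · simp [hw1.symm, hw0]
    · simp [hw0.symm, hw2.symm]
  have hlim : ∀ γ : K, Tendsto
        (fun n : ℕ =>
          ((Finset.univ.filter (fun x : Fin (j + n) → K =>
              evalE 9 x + F (fun i => x (Fin.castAdd n i)) = γ)).card : ℝ) /
            (4 : ℝ) ^ (j + n))
        atTop (𝓝 ((∑ t : K, f t * c (γ + t)) / (4096 * 4 ^ j))) := by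
    intro γ
    have h := perturbed_limit (stepS w) 0 (by simp [stepS]) (stepS_chars w hw0 hw1 hw2) j
      (fun β v => bitK w (bits v) + F β = γ)
    have hG : Fintype.card G16 = 4096 := by simp [G16, ZMod.card]
    rw [hK, hG] at h
    simp only [← evalE_nine w hw hall] at h
    convert h using 2
    · norm_num
    have hcg : ∀ β : Fin j → K,
        ((Finset.univ.filter (fun v : G16 => bitK w (bits v) + F β = γ)).card : ℝ) = c (γ + F β) := by
      intro β
      simp only [hc]
      congr 2
      ext v
      simp only [Finset.mem_filter, Finset.mem_univ, true_and]
      rw [← eq_sub_iff_add_eq, CharTwo.sub_eq_add]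
    simp only [hcg]
    have hfib : ∑ β : Fin j → K, c (γ + F β) = ∑ t : K, f t * c (γ + t) := by
      rw [← Finset.sum_fiberwise (s := Finset.univ) (g := F)]
      refine Finset.sum_congr rfl fun t _ => ?_
      rw [Finset.sum_congr rfl (g := fun _ => c (γ + t)), Finset.sum_const, nsmul_eq_mul]
      intro β hβ
      rw [(Finset.mem_filter.1 hβ).2]
    rw [hfib]
    norm_num
  have hstep : (∀ γ : K,
      Tendsto
        (fun n : ℕ =>
          ((Finset.univ.filter (fun x : Fin (j + n) → K =>
              evalE 9 x + F (fun i => x (Fin.castAdd n i)) = γ)).card : ℝ) /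
            (4 : ℝ) ^ (j + n))
        atTop (𝓝 (1 / 4))) ↔ ∀ γ : K, ∑ t : K, f t * c (γ + t) = 1024 * 4 ^ j := by
    refine forall_congr' fun γ => ?_
    have hp : (0 : ℝ) < 4 ^ j := by positivity
    constructor
    · intro h
      have := tendsto_nhds_unique h (hlim γ)
      field_simp at this
      linarith
    · intro h
      have h' := hlim γ
      rw [h] at h'
      convert h' using 2
      field_simp
      norm_num
  rw [hstep]
  have hfin : (∀ t : K,
      (Finset.univ.filter (fun β : Fin j → K => F β = t)).card = 4 ^ (j - 1)) ↔
      ∀ t : K, f t = 4 ^ j / 4 := by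
    refine forall_congr' fun t => ?_
    obtain ⟨i, rfl⟩ : ∃ i, j = i + 1 := ⟨j - 1, by omega⟩
    simp only [hf, Nat.add_sub_cancel, pow_succ, mul_div_assoc]
    rw [div_self (by norm_num : (4 : ℝ) ≠ 0), mul_one]
    norm_cast
  rw [hfin]
  have e0 : ∑ t : K, f t * c (0 + t) = f 0 * 1440 + f 1 * 928 + f w * 864 + f (w + 1) * 864 := by
    rw [hsumK]
    simp only [zero_add, c0, c1, c2, c3]
  have e1 : ∑ t : K, f t * c (1 + t) = f 0 * 928 + f 1 * 1440 + f w * 864 + f (w + 1) * 864 := by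
    rw [hsumK, show (1 : K) + 0 = 1 by ring, show (1 : K) + 1 = 0 by linear_combination h2,
      show 1 + w = w + 1 by ring, show 1 + (w + 1) = w by linear_combination h2, c0, c1, c2, c3]
  have e2 : ∑ t : K, f t * c (w + t) = f 0 * 864 + f 1 * 864 + f w * 1440 + f (w + 1) * 928 := by
    rw [hsumK, show w + 0 = w by ring, show w + w = 0 by linear_combination w * h2,
      show w + (w + 1) = 1 by linear_combination w * h2, c0, c1, c2, c3]
  have e3 : ∑ t : K, f t * c (w + 1 + t) =
      f 0 * 864 + f 1 * 864 + f w * 928 + f (w + 1) * 1440 := by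
    rw [hsumK, show w + 1 + 0 = w + 1 by ring, show w + 1 + 1 = w by linear_combination h2,
      show w + 1 + w = 1 by linear_combination w * h2,
      show w + 1 + (w + 1) = 0 by linear_combination (w + 1) * h2, c0, c1, c2, c3]
  constructor
  · intro h
    have g0 := h 0
    have g1 := h 1
    have g2 := h w
    have g3 := h (w + 1)
    rw [e0] at g0
    rw [e1] at g1
    rw [e2] at g2
    rw [e3] at g3
    intro t
    rcases hall t with rfl | rfl | rfl | rfl <;> linarith
  · intro h γ
    rcases hall γ with rfl | rfl | rfl | rfl
    · rw [e0, h, h, h, h]; ring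
    · rw [e1, h, h, h, h]; ring
    · rw [e2, h, h, h, h]; ring
    · rw [e3, h, h, h, h]; ring
end

section
/- Let 𝔽_8 be a field with 8 elements and α ∈ 𝔽_8 with α³ + α + 1 = 0. Then for each k ∈ {1, 2, 3, 4, 6} and every β ∈ 𝔽_8, the real sequence (1/8^n) · #{x ∈ 𝔽_8^n : e_k(x) = β} converges to 1/8 as n → ∞. In particular, e_{n,3} is asymptotically balanced over 𝔽_8 even though 3 is not of the form d·2^ℓ with 1 ≤ d ≤ 1. -/
open Filter Topology

open Polynomial in
/-- The generating polynomial of a tuple. -/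
noncomputable def genP {K : Type*} [Field K] {n : ℕ} (x : Fin n → K) : K[X] :=
  ∏ i, (1 + C (x i) * X)

open Polynomial in
theorem genP_coeff {K : Type*} [Field K] {n : ℕ} (x : Fin n → K) (k : ℕ) :
    (genP x).coeff k = evalE k x := by
  classical
  unfold genP evalE
  rw [Finset.esymm_map_val, Finset.prod_one_add, finsetSum_coeff]
  have h : ∀ t : Finset (Fin n), (∏ i ∈ t, (C (x i) * X : K[X])).coeff k
      = if t.card = k then ∏ i ∈ t, x i else 0 := by
    intro t
    rw [Finset.prod_mul_distrib, Finset.prod_const, ← map_prod, coeff_C_mul, coeff_X_pow]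
    by_cases hk : t.card = k
    · simp [hk]
    · simp [hk, Ne.symm hk]
  simp_rw [h]
  rw [← Finset.sum_filter, Finset.powersetCard_eq_filter]

open Polynomial in
theorem genP_coeff_zero {K : Type*} [Field K] {n : ℕ} (x : Fin n → K) :
    (genP x).coeff 0 = 1 := by
  rw [genP, coeff_zero_eq_eval_zero, eval_prod]
  simp

open Polynomial in
/-- Unnormalised walk average. -/
noncomputable def walkS {K : Type*} [Field K] [Fintype K] (n : ℕ) (f : K[X] → ℝ) (g : K[X]) : ℝ :=
  ∑ x : Fin n → K, f (g * genP x)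

open Polynomial in
theorem walkS_add {K : Type*} [Field K] [Fintype K] (m n : ℕ) (f : K[X] → ℝ) (g : K[X]) :
    walkS (m + n) f g = ∑ y : Fin m → K, walkS n f (g * genP y) := by
  unfold walkS
  rw [← (Fin.appendEquiv m n).sum_comp, Fintype.sum_prod_type]
  refine Finset.sum_congr rfl fun y _ => Finset.sum_congr rfl fun z _ => ?_
  simp [genP, Fin.appendEquiv, Fin.prod_univ_add, mul_assoc]

open Polynomial in
theorem walkS_bound {K : Type*} [Field K] [Fintype K] (hK : Fintype.card K = 8)
    (f : K[X] → ℝ) (hf : ∀ g, |f g| ≤ 1) {m : ℕ} (y : Fin m → K) (hy : y ≠ 0)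
    (hc : ∀ g : K[X], g.coeff 0 = 1 → f (g * genP y) + f g = 0) (q s : ℕ) :
    ∀ g : K[X], g.coeff 0 = 1 → |walkS (q * m + s) f g| ≤ ((8 : ℝ) ^ m - 2) ^ q * 8 ^ s := by
  classical
  induction q with
  | zero =>
    intro g _
    rw [zero_mul, zero_add, pow_zero, one_mul]
    refine (Finset.abs_sum_le_sum_abs _ _).trans ((Finset.sum_le_sum fun x _ => hf _).trans ?_)
    simp [hK]
  | succ q ih =>
    intro g hg
    have e : (q + 1) * m + s = m + (q * m + s) := by ring
    rw [e, walkS_add]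
    have h0 : genP (0 : Fin m → K) = 1 := by simp [genP]
    have hy0 : (0 : Fin m → K) ∈ Finset.univ.erase y := by simp [Ne.symm hy]
    rw [← Finset.add_sum_erase _ _ (Finset.mem_univ y), ← Finset.add_sum_erase _ _ hy0,
      ← add_assoc]
    have hz : walkS (q * m + s) f (g * genP y) + walkS (q * m + s) f (g * genP (0 : Fin m → K))
        = 0 := by
      rw [h0, mul_one]
      unfold walkS
      rw [← Finset.sum_add_distrib]
      refine Finset.sum_eq_zero fun x _ => ?_
      rw [mul_right_comm]
      exact hc _ (by rw [mul_coeff_zero, hg, genP_coeff_zero, one_mul])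
    rw [hz, zero_add]
    refine (Finset.abs_sum_le_sum_abs _ _).trans ((Finset.sum_le_sum fun x _ =>
      ih (g * genP x) (by rw [mul_coeff_zero, hg, genP_coeff_zero, one_mul])).trans ?_)
    rw [Finset.sum_const, Finset.card_erase_of_mem hy0, Finset.card_erase_of_mem (Finset.mem_univ _),
      Finset.card_univ, Fintype.card_fun, hK, Fintype.card_fin, nsmul_eq_mul, Nat.sub_sub]
    have hm : m ≠ 0 := by
      rintro rfl
      exact hy (Subsingleton.elim _ _)
    have h8 : 2 ≤ 8 ^ m := by
      calc 2 ≤ 8 ^ 1 := by norm_num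
        _ ≤ 8 ^ m := Nat.pow_le_pow_right (by norm_num) (by omega)
    push_cast [Nat.cast_sub h8]
    apply le_of_eq
    ring

open Polynomial in
theorem walkS_tendsto {K : Type*} [Field K] [Fintype K] (hK : Fintype.card K = 8)
    (f : K[X] → ℝ) (hf : ∀ g, |f g| ≤ 1) {m : ℕ} (y : Fin m → K) (hy : y ≠ 0)
    (hc : ∀ g : K[X], g.coeff 0 = 1 → f (g * genP y) + f g = 0) :
    Tendsto (fun n => walkS n f 1 / 8 ^ n) atTop (𝓝 0) := by
  have hm : m ≠ 0 := by
    rintro rfl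
    exact hy (Subsingleton.elim _ _)
  have h8 : (2 : ℝ) ≤ 8 ^ m := by
    calc (2 : ℝ) ≤ 8 ^ 1 := by norm_num
      _ ≤ 8 ^ m := pow_le_pow_right₀ (by norm_num) (by omega)
  have hlim : Tendsto (fun n : ℕ => (((8 : ℝ) ^ m - 2) / 8 ^ m) ^ (n / m)) atTop (𝓝 0) := by
    have h1 : Tendsto (fun q : ℕ => (((8 : ℝ) ^ m - 2) / 8 ^ m) ^ q) atTop (𝓝 0) := by
      apply tendsto_pow_atTop_nhds_zero_of_lt_one
      · apply div_nonneg <;> linarith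
      · rw [div_lt_one (by positivity)]; linarith
    exact h1.comp (Nat.tendsto_div_const_atTop hm)
  refine squeeze_zero_norm (fun n => ?_) hlim
  have hb := walkS_bound hK f hf y hy hc (n / m) (n % m) 1 (by simp)
  have hn : n / m * m + n % m = n := by rw [mul_comm]; exact Nat.div_add_mod n m
  rw [hn] at hb
  rw [Real.norm_eq_abs, abs_div, abs_of_pos (by positivity : (0 : ℝ) < 8 ^ n),
    div_le_iff₀ (by positivity)]
  refine hb.trans (le_of_eq ?_)
  have e : (8 : ℝ) ^ n = (8 ^ m) ^ (n / m) * 8 ^ (n % m) := by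
    rw [← pow_mul, ← pow_add, mul_comm m, hn]
  rw [e, div_pow]
  field_simp

open Polynomial in
/-- The polynomial `1 + d X^k` is, modulo `X^(k+1)`, a product of factors `1 + x X`. -/
def ReachF {K : Type*} [Field K] (k : ℕ) (d : K) : Prop :=
  ∃ (l : List K) (Q : K[X]),
    (l.map fun x => 1 + C x * X).prod = 1 + C d * X ^ k + X ^ (k + 1) * Q

open Polynomial in
theorem ReachF.double {K : Type*} [Field K] (h2 : (2 : K) = 0) {k : ℕ} (hk : k ≠ 0) {d : K}
    (h : ReachF k d) : ReachF (2 * k) (d ^ 2) := by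
  obtain ⟨l, Q, h⟩ := h
  have h2' : (2 : K[X]) = 0 := by
    rw [← C_ofNat, h2, C_0]
  refine ⟨l ++ l, X * Q ^ 2, ?_⟩
  rw [List.map_append, List.prod_append, h, C_pow]
  linear_combination (C d * X ^ k + X ^ (k + 1) * Q + C d * X ^ k * X ^ (k + 1) * Q) * h2'

open Polynomial in
theorem ReachF.coeff {K : Type*} [Field K] {k : ℕ} (hk : k ≠ 0) {d : K}
    (h : ReachF k d) : ∃ (m : ℕ) (y : Fin m → K), ∀ g : K[X], g.coeff 0 = 1 →
      (g * genP y).coeff k = g.coeff k + d := by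
  obtain ⟨l, Q, h⟩ := h
  refine ⟨l.length, l.get, fun g hg => ?_⟩
  have e : genP l.get = (l.map fun x => 1 + C x * X).prod := by
    rw [genP, ← List.prod_ofFn]
    congr 1
    conv_rhs => rw [← List.ofFn_get l, List.map_ofFn]
    rfl
  rw [e, h]
  have e2 : g * (1 + C d * X ^ k + X ^ (k + 1) * Q)
      = g + C d * (g * X ^ k) + (g * Q) * X ^ (k + 1) := by ring
  rw [e2, coeff_add, coeff_add, coeff_C_mul, coeff_mul_X_pow', coeff_mul_X_pow']
  simp [hg]

theorem two_eq_zero_F8 {K : Type*} [Field K] [Fintype K] (hK : Fintype.card K = 8) :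
    (2 : K) = 0 := by
  have h : ((Fintype.card K : ℕ) : K) = 0 := Nat.cast_card_eq_zero K
  rw [hK] at h
  have : (2 : K) ^ 3 = 0 := by
    rw [← h]; norm_num
  exact pow_eq_zero_iff (by norm_num) |>.1 this

theorem pow8_F8 {K : Type*} [Field K] [Fintype K] (hK : Fintype.card K = 8) (d : K) :
    d ^ 8 = d := by
  rw [← hK]; exact FiniteField.pow_card d

open Polynomial in
theorem reachF_one {K : Type*} [Field K] (d : K) : ReachF 1 d :=
  ⟨[d], 0, by simp⟩

open Polynomial in
theorem reachF_three {K : Type*} [Field K] [Fintype K] (hK : Fintype.card K = 8)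
    (α : K) (hα : α ^ 3 + α + 1 = 0) (d : K) : ReachF 3 d := by
  have h2 := two_eq_zero_F8 hK
  have h2' : (2 : K[X]) = 0 := by
    rw [← C_ofNat, h2, C_0]
  have hne : α + α ^ 2 ≠ 0 := by
    intro h
    have : (1 : K) = 0 := by
      linear_combination hα - (α - 1) * h - α * h2
    exact one_ne_zero this
  obtain ⟨x, hx⟩ : ∃ x : K, x ^ 3 * (α + α ^ 2) = d := by
    refine ⟨(d / (α + α ^ 2)) ^ 5, ?_⟩
    have h8 := pow8_F8 hK (d / (α + α ^ 2))
    have : ((d / (α + α ^ 2)) ^ 5) ^ 3 = d / (α + α ^ 2) := by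
      linear_combination ((d / (α + α ^ 2)) ^ 7 + 1) * h8
    rw [this, div_mul_cancel₀ _ hne]
  set b := α * x with hb
  have hd : x * b * (x + b) = d := by rw [← hx, hb]; ring
  set c := x * b + (x + b) ^ 2 with hc
  have hz : (c ^ 4) ^ 2 = c := by
    rw [← pow_mul]; exact pow8_F8 hK c
  set z := c ^ 4
  have hd' : C x * C b * (C x + C b) = C d := by rw [← hd]; simp
  have hz' : C z ^ 2 = C c := by rw [← hz]; simp
  have hc' : C c = C x * C b + (C x + C b) ^ 2 := by rw [hc]; simp
  refine ⟨[x, b, x + b, z, z], C c ^ 2 + C c * C d * X, ?_⟩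
  simp only [List.map_cons, List.map_nil, List.prod_cons, List.prod_nil, mul_one, C_add]
  have p1 : (1 + C x * X) * ((1 + C b * X) * (1 + (C x + C b) * X))
      = 1 + C c * X ^ 2 + C d * X ^ 3 := by
    linear_combination (C x + C b) * X * h2' + X ^ 3 * hd' - X ^ 2 * hc'
  have p2 : (1 + C z * X) * (1 + C z * X) = 1 + C c * X ^ 2 := by
    linear_combination C z * X * h2' + X ^ 2 * hz'
  calc _ = ((1 + C x * X) * ((1 + C b * X) * (1 + (C x + C b) * X)))
        * ((1 + C z * X) * (1 + C z * X)) := by ring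
    _ = _ := by
      rw [p1, p2]
      linear_combination C c * X ^ 2 * h2'

theorem reachF_all {K : Type*} [Field K] [Fintype K] (hK : Fintype.card K = 8)
    (α : K) (hα : α ^ 3 + α + 1 = 0) (k : ℕ) (hk : k ∈ ({1, 2, 3, 4, 6} : Finset ℕ)) (d : K) :
    ReachF k d := by
  have h2 := two_eq_zero_F8 hK
  have dbl : ∀ j : ℕ, j ≠ 0 → (∀ d : K, ReachF j d) → ∀ d : K, ReachF (2 * j) d := by
    intro j hj h d
    have := (h (d ^ 4)).double h2 hj
    rwa [← pow_mul, pow8_F8 hK] at this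
  have r1 : ∀ d : K, ReachF 1 d := reachF_one
  have r3 := reachF_three hK α hα
  have r2 := dbl 1 (by norm_num) r1
  have r4 := dbl 2 (by norm_num) r2
  have r6 := dbl 3 (by norm_num) r3
  simp only [Finset.mem_insert, Finset.mem_singleton] at hk
  rcases hk with rfl | rfl | rfl | rfl | rfl
  exacts [r1 d, r2 d, r3 d, r4 d, r6 d]

open Polynomial in
theorem diff_tendsto {K : Type*} [Field K] [Fintype K] [DecidableEq K]
    (hK : Fintype.card K = 8) {k : ℕ} (hk : k ≠ 0) {d : K} (h : ReachF k d) (β : K) :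
    Tendsto (fun n : ℕ =>
      ((Finset.univ.filter (fun x : Fin n → K => evalE k x = β)).card : ℝ) / (8 : ℝ) ^ n -
      ((Finset.univ.filter (fun x : Fin n → K => evalE k x = β + d)).card : ℝ) / (8 : ℝ) ^ n)
      atTop (𝓝 0) := by
  by_cases hd : d = 0
  · subst hd
    simp
  obtain ⟨m, y, hy⟩ := h.coeff hk
  have hy0 : y ≠ 0 := by
    rintro rfl
    have := hy 1 (by simp)
    simp [genP] at this
    exact hd this
  have hdd : d + d = 0 := by
    linear_combination d * two_eq_zero_F8 hK
  let f : K[X] → ℝ := fun g =>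
    (if g.coeff k = β then 1 else 0) - (if g.coeff k = β + d then 1 else 0)
  have key := walkS_tendsto hK f (by
    intro g
    simp only [f]
    split_ifs <;> norm_num) y hy0 (by
    intro g hg
    simp only [f]
    rw [hy g hg]
    have e1 : g.coeff k + d = β ↔ g.coeff k = β + d :=
      ⟨fun h => by linear_combination h - hdd, fun h => by linear_combination h + hdd⟩
    have e2 : g.coeff k + d = β + d ↔ g.coeff k = β := add_left_inj d
    simp only [e1, e2]
    ring)
  refine key.congr fun n => ?_
  rw [← sub_div]
  congr 1
  simp only [walkS, f, one_mul, genP_coeff, Finset.sum_sub_distrib, Finset.sum_boole]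

/-- **concluding remarks.** Over `𝔽_8 = 𝔽_2(α)` with `α³ + α + 1 = 0`, for each
`k ∈ {1,2,3,4,6}` the limiting value distribution of `e_k` is uniform: every `β ∈ 𝔽_8` is
attained with limiting probability `1/8`.  In particular `e_{n,3}` is asymptotically balanced
even though `3` is not of the form `d ⬝ 2^ℓ` with `1 ≤ d ≤ 1`. -/
theorem limit_distribution_F8_uniform (K : Type*) [Field K] [Fintype K] [DecidableEq K]
    (hK : Fintype.card K = 8) (α : K) (hα : α ^ 3 + α + 1 = 0) :
    (∀ k ∈ ({1, 2, 3, 4, 6} : Finset ℕ), ∀ β : K,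
      Tendsto (fun n : ℕ =>
          ((Finset.univ.filter (fun x : Fin n → K => evalE k x = β)).card : ℝ) / (8 : ℝ) ^ n)
        atTop (𝓝 (1 / 8))) ∧
    ¬ ∃ (d ℓ : ℕ), 1 ≤ d ∧ d ≤ 1 ∧ 3 = d * 2 ^ ℓ := by
  refine ⟨fun k hk β => ?_, ?_⟩
  · have hk0 : k ≠ 0 := by
      rintro rfl
      simp at hk
    have hlim := tendsto_finsetSum (Finset.univ : Finset K) fun d _ =>
      diff_tendsto hK hk0 (reachF_all hK α hα k hk d) β
    have hlim2 := (hlim.div_const 8).add_const (1 / 8 : ℝ)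
    simp only [Finset.sum_const_zero, zero_div, zero_add] at hlim2
    refine hlim2.congr fun n => ?_
    have hsum : ∑ d : K,
        ((Finset.univ.filter (fun x : Fin n → K => evalE k x = β + d)).card : ℝ) / (8 : ℝ) ^ n
        = 1 := by
      refine (Equiv.sum_comp (Equiv.addLeft β) (fun b : K =>
        ((Finset.univ.filter (fun x : Fin n → K => evalE k x = b)).card : ℝ) / (8 : ℝ) ^ n)).trans ?_
      rw [← Finset.sum_div, ← Nat.cast_sum,
        ← Finset.card_eq_sum_card_fiberwise (fun x _ => Finset.mem_coe.2 (Finset.mem_univ _))]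
      simp [hK]
    rw [Finset.sum_sub_distrib, hsum, Finset.sum_const, Finset.card_univ, hK]
    simp only [nsmul_eq_mul]
    push_cast
    ring
  · rintro ⟨d, l, h1, h2, h3⟩
    obtain rfl : d = 1 := by omega
    rcases l with _ | l
    · simp at h3
    · rw [pow_succ] at h3
      omega
end
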